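/- arXiv:1701.00653 — 3 statements merged into one kernel-verified Lean document; each statement's English description precedes it below -/
import Mathlib

section
/- For every n ≥ 1, the gap-(n+1) cardinal transfer principle implies the gap-n cardinal transfer principle. That is, if for all infinite cardinals κ, λ every countable theory with a (κ^{+(n+1)}, κ)-model has a (λ^{+(n+1)}, λ)-model, then for all infinite cardinals κ, λ every countable theory with a (κ^{+n}, κ)-model has a (λ^{+n}, λ)-model. -/
open FirstOrder Cardinal

/-- `T` has a `(κ, lam)`-model: a model of cardinality `κ` in which the unary
predicate `U` is interpreted by a set of cardinality `lam`. -/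
def HasModelPair (L : FirstOrder.Language.{0,0}) (U : L.Relations 1) (T : L.Theory)
    (κ lam : Cardinal.{0}) : Prop :=
  ∃ (M : Type) (i : L.Structure M), T.Model M ∧ #M = κ ∧
    #{x : M | @Language.Structure.RelMap L M i 1 U ![x]} = lam

/-- The gap-`n` cardinal transfer principle: for all infinite cardinals `κ, lam`,
every countable theory (in a language with a distinguished unary predicate)
with a `(κ^{+n}, κ)`-model has a `(lam^{+n}, lam)`-model. -/
def GapTransfer (n : ℕ) : Prop :=
  ∀ κ lam : Cardinal.{0}, ℵ₀ ≤ κ → ℵ₀ ≤ lam →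
    ∀ (L : FirstOrder.Language.{0,0}) (U : L.Relations 1) (T : L.Theory), L.card ≤ ℵ₀ →
      HasModelPair L U T ((Order.succ)^[n] κ) κ →
      HasModelPair L U T ((Order.succ)^[n] lam) lam

namespace Cardinal

variable {X : Type}

/-- If any two elements of `B` are connected by a section of `F` over `A`, then
`B` has cardinality at most the successor of `#A`. -/
theorem mk_le_succ_of_sections {A B : Set X} {F : X → X → X} {μ : Cardinal.{0}}
    (hμ : ℵ₀ ≤ μ) (hA : #A ≤ μ)
    (hF : ∀ x ∈ B, ∀ y ∈ B, (∃ z ∈ A, F z x = y) ∨ ∃ z ∈ A, F z y = x) :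
    #B ≤ Order.succ μ := by
  by_contra! hB
  obtain ⟨C, hCB, hC⟩ := le_mk_iff_exists_subset.1 hB.le
  have hsec (c : X) : #((fun z => F z c) '' A) ≤ μ := mk_image_le.trans hA
  have hcover : B ⊆ ⋃ c ∈ C, (fun z => F z c) '' A := by
    intro x hx
    by_contra hxC
    have hsub : C ⊆ (fun z => F z x) '' A := by
      intro c hc
      rcases hF x hx c (hCB hc) with ⟨z, hz, h⟩ | ⟨z, hz, h⟩
      · exact ⟨z, hz, h⟩
      · exact absurd (Set.mem_biUnion hc (Set.mem_image_of_mem _ hz)) (h ▸ hxC)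
    have := (mk_le_mk_of_subset hsub).trans (hsec x)
    exact (Order.lt_succ μ).not_ge (hC ▸ this)
  have hle : #B ≤ Order.succ μ * μ := by
    refine (mk_le_mk_of_subset hcover).trans ((mk_biUnion_le _ C).trans ?_)
    rw [hC]
    gcongr
    exact ciSup_le' fun c => hsec c
  rw [mul_eq_left (hμ.trans (Order.le_succ μ)) (Order.le_succ μ)
    (aleph0_pos.trans_le hμ).ne'] at hle
  exact hB.not_ge hle

/-- A set of cardinality at most `#A` is covered by an image of `A`. -/
theorem exists_subset_image {A S : Set X} (h : #S ≤ #A) :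
    ∃ g : X → X, S ⊆ g '' A := by
  obtain rfl | ⟨x₀, hx₀⟩ := S.eq_empty_or_nonempty
  · exact ⟨id, Set.empty_subset _⟩
  have : Nonempty S := ⟨⟨x₀, hx₀⟩⟩
  obtain ⟨e⟩ := (le_def _ _).1 h
  classical
  refine ⟨fun z => if hz : z ∈ A then ((Function.invFun e ⟨z, hz⟩ : S) : X) else z, fun x hx => ?_⟩
  refine ⟨e ⟨x, hx⟩, (e ⟨x, hx⟩).2, ?_⟩
  simp [Function.leftInverse_invFun e.injective ⟨x, hx⟩]

/-- Converse of `mk_le_succ_of_sections`. -/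
theorem exists_sections {A B : Set X} (hA : ℵ₀ ≤ #A) (hB : #B ≤ Order.succ #A) :
    ∃ F : X → X → X,
      ∀ x ∈ B, ∀ y ∈ B, (∃ z ∈ A, F z x = y) ∨ ∃ z ∈ A, F z y = x := by
  rw [← mk_ord_toType (Order.succ #A)] at hB
  obtain ⟨e⟩ := hB
  have hseg (x : B) : ∃ g : X → X, Subtype.val '' {y : B | e y ≤ e x} ⊆ g '' A := by
    apply exists_subset_image
    apply mk_image_le.trans
    have h₁ : #{y : B | e y ≤ e x} ≤ #(Set.Iic (e x)) :=
      mk_le_of_injective (f := fun y => ⟨e y.1, y.2⟩) fun y z h =>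
        Subtype.ext (e.injective (congrArg Subtype.val h))
    have h₂ : #(Set.Iic (e x)) ≤ #(Set.Iio (e x)) + 1 := by
      rw [← Set.Iio_insert]
      exact mk_insert_le
    have h₃ : #(Set.Iio (e x)) ≤ #A := Order.lt_succ_iff.1 <| by
      simpa using mk_Iio_lt (e x)
    calc #{y : B | e y ≤ e x} ≤ #(Set.Iio (e x)) + 1 := h₁.trans h₂
      _ ≤ #A + 1 := by gcongr
      _ = #A := add_one_eq hA
  choose g hg using hseg
  classical
  refine ⟨fun z x => if hx : x ∈ B then g ⟨x, hx⟩ z else z, fun x hx y hy => ?_⟩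
  simp only [hx, hy, dif_pos]
  rcases le_total (e ⟨y, hy⟩) (e ⟨x, hx⟩) with h | h
  · exact Or.inl (hg ⟨x, hx⟩ ⟨⟨y, hy⟩, h, rfl⟩)
  · exact Or.inr (hg ⟨y, hy⟩ ⟨⟨x, hx⟩, h, rfl⟩)

end Cardinal

namespace FirstOrder.Language

variable {L L' : Language.{0, 0}}

namespace BoundedFormula

/-- The relativization of a formula to a unary predicate of a larger language. -/
def relativize (φ : L →ᴸ L') (P : L'.Relations 1) {α : Type} :
    ∀ {n : ℕ}, L.BoundedFormula α n → L'.BoundedFormula α n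
  | _, falsum => falsum
  | _, equal t s => equal (φ.onTerm t) (φ.onTerm s)
  | _, rel R ts => rel (φ.onRelation R) fun i => φ.onTerm (ts i)
  | _, imp f g => (relativize φ P f).imp (relativize φ P g)
  | n, all f => ((P.boundedFormula₁ (&(Fin.last n))).imp (relativize φ P f)).all

theorem realize_relativize (φ : L →ᴸ L') (P : L'.Relations 1) {α M N : Type}
    [L.Structure M] [L.Structure N] [L'.Structure N] [φ.IsExpansionOn N] (j : M ↪[L] N)
    (hj : ∀ x : N, Structure.RelMap P ![x] ↔ x ∈ Set.range j) {n : ℕ}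
    (f : L.BoundedFormula α n) (v : α → M) (xs : Fin n → M) :
    (f.relativize φ P).Realize (j ∘ v) (j ∘ xs) ↔ f.Realize v xs := by
  induction f with
  | falsum => rfl
  | equal t s =>
    simp only [relativize, Realize, LHom.realize_onTerm, ← Sum.comp_elim,
      HomClass.realize_term, EmbeddingLike.apply_eq_iff_eq]
  | rel R ts =>
    simp only [relativize, Realize, LHom.realize_onTerm, ← Sum.comp_elim,
      HomClass.realize_term, LHom.map_onRelation]
    exact j.map_rel R fun i => (ts i).realize (Sum.elim v xs)
  | imp f g hf hg => simp only [relativize, Realize, hf, hg]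
  | all f hf =>
    simp only [relativize, Realize, realize_rel₁]
    simp only [Function.comp_apply, Term.realize_var, Sum.elim_inr, Fin.snoc_last, hj, Set.forall_mem_range,
      ← Fin.comp_snoc, hf]

end BoundedFormula

/-- Function symbols enumerating the levels of a chain. -/
inductive ChainFunctions : ℕ → Type
  | sec (i : ℕ) : ChainFunctions 2

/-- Predicates naming the levels of a chain. -/
inductive ChainRelations : ℕ → Type
  | level (i : ℕ) : ChainRelations 1

/-- The language of chains of sets, each enumerating sections of the next. -/
def chain : Language.{0, 0} := ⟨ChainFunctions, ChainRelations⟩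

theorem card_sum_chain_le (hL : L.card ≤ ℵ₀) : (L.sum chain).card ≤ ℵ₀ := by
  have h : chain.card ≤ ℵ₀ := by
    refine mk_le_aleph0_iff.2 (Function.Injective.countable (β := ℕ ⊕ ℕ)
      (f := Sum.map (fun | ⟨_, .sec i⟩ => i) (fun | ⟨_, .level i⟩ => i)) ?_)
    apply Function.Injective.sumMap
    · rintro ⟨_, ⟨i⟩⟩ ⟨_, ⟨j⟩⟩ h
      cases h; rfl
    · rintro ⟨_, ⟨i⟩⟩ ⟨_, ⟨j⟩⟩ h
      cases h; rfl
  rw [card_sum, Cardinal.lift_id, Cardinal.lift_id]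
  exact add_le_aleph0.2 ⟨hL, h⟩

namespace chain

/-- The predicate for the `i`-th level. -/
def level (L : Language.{0, 0}) (i : ℕ) : (L.sum chain).Relations 1 :=
  Sum.inr (ChainRelations.level i)

/-- The function symbol whose sections over the `i`-th level cover the next level. -/
def sec (L : Language.{0, 0}) (i : ℕ) : (L.sum chain).Functions 2 :=
  Sum.inr (ChainFunctions.sec i)

/-- The predicate `U` in the language expanded by a chain. -/
def base (U : L.Relations 1) : (L.sum chain).Relations 1 :=
  Sum.inl U

/-- Every element lies in the `i`-th level. -/
def topSentence (L : Language.{0, 0}) (i : ℕ) : (L.sum chain).Sentence :=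
  ((level L i).boundedFormula₁ (&0) : (L.sum chain).BoundedFormula Empty 1).alls

/-- The `0`-th level is the distinguished predicate `U`. -/
def baseSentence (U : L.Relations 1) : (L.sum chain).Sentence :=
  (((level L 0).boundedFormula₁ (&0)).iff
    ((base U).boundedFormula₁ (&0)) :
      (L.sum chain).BoundedFormula Empty 1).alls

/-- The `0`-th level is contained in the `i`-th. -/
def subsetSentence (L : Language.{0, 0}) (i : ℕ) : (L.sum chain).Sentence :=
  (((level L 0).boundedFormula₁ (&0)).imp ((level L i).boundedFormula₁ (&0)) :
      (L.sum chain).BoundedFormula Empty 1).alls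

/-- The values of `f` lie in the `i`-th level. -/
def closedSentence (i : ℕ) {k : ℕ} (f : L.Functions k) : (L.sum chain).Sentence :=
  ((level L i).boundedFormula₁
    (Term.func (L := L.sum chain) (Sum.inl f) fun j => &j) :
      (L.sum chain).BoundedFormula Empty k).alls

/-- Any two elements of level `i + 1` are connected by a section over level `i`. -/
def stepSentence (L : Language.{0, 0}) (i : ℕ) : (L.sum chain).Sentence :=
  (((level L (i + 1)).boundedFormula₁ (&0)).imp
    (((level L (i + 1)).boundedFormula₁ (&1)).imp
      (((level L i).boundedFormula₁ (&2) ⊓ ((sec L i).apply₂ (&2) (&0)).bdEqual (&1)).ex ⊔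
        ((level L i).boundedFormula₁ (&2) ⊓ ((sec L i).apply₂ (&2) (&1)).bdEqual (&0)).ex)) :
      (L.sum chain).BoundedFormula Empty 2).alls

variable {N : Type} [(L.sum chain).Structure N]

/-- The interpretation of the `i`-th level. -/
def levelSet (L : Language.{0, 0}) (N : Type) [(L.sum chain).Structure N] (i : ℕ) : Set N :=
  {x | Structure.RelMap (level L i) ![x]}

theorem realize_topSentence (i : ℕ) :
    N ⊨ topSentence L i ↔ levelSet L N i = Set.univ := by
  simp only [topSentence, Sentence.Realize, BoundedFormula.realize_alls,
    BoundedFormula.realize_rel₁, Set.eq_univ_iff_forall]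
  exact ⟨fun h x => h ![x], fun h xs => h (xs 0)⟩

theorem realize_baseSentence (U : L.Relations 1) :
    N ⊨ baseSentence U ↔
      levelSet L N 0 = {x | Structure.RelMap (base U) ![x]} := by
  simp only [baseSentence, Sentence.Realize, BoundedFormula.realize_alls,
    BoundedFormula.realize_iff, BoundedFormula.realize_rel₁, Set.ext_iff]
  exact ⟨fun h x => h ![x], fun h xs => h (xs 0)⟩

theorem realize_subsetSentence (i : ℕ) :
    N ⊨ subsetSentence L i ↔ levelSet L N 0 ⊆ levelSet L N i := by
  simp only [subsetSentence, Sentence.Realize, BoundedFormula.realize_alls,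
    BoundedFormula.realize_imp, BoundedFormula.realize_rel₁]
  exact ⟨fun h x => h ![x], fun h xs => @h (xs 0)⟩

theorem realize_closedSentence (i : ℕ) {k : ℕ} (f : L.Functions k) :
    N ⊨ closedSentence i f ↔
      ∀ xs : Fin k → N, Structure.funMap (L := L.sum chain) (Sum.inl f) xs ∈ levelSet L N i := by
  simp only [closedSentence, Sentence.Realize, BoundedFormula.realize_alls,
    BoundedFormula.realize_rel₁]
  rfl

theorem realize_stepSentence (i : ℕ) :
    N ⊨ stepSentence L i ↔ ∀ x ∈ levelSet L N (i + 1), ∀ y ∈ levelSet L N (i + 1),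
      (∃ z ∈ levelSet L N i, Structure.funMap (sec L i) ![z, x] = y) ∨
        ∃ z ∈ levelSet L N i, Structure.funMap (sec L i) ![z, y] = x := by
  simp only [stepSentence, Sentence.Realize, BoundedFormula.realize_alls,
    BoundedFormula.realize_imp, BoundedFormula.realize_rel₁, BoundedFormula.realize_sup,
    BoundedFormula.realize_ex, BoundedFormula.realize_inf, BoundedFormula.realize_bdEqual,
    Term.realize_functions_apply₂]
  exact ⟨fun h x hx y hy => h ![x, y] hx hy, fun h xs hx hy => h (xs 0) hx (xs 1) hy⟩

/-- The theory of a chain of levels `0, …, n + 1`, starting at `U`, exhausting the universe, and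
carrying a model of `T` on level `n`. -/
def theory (U : L.Relations 1) (T : L.Theory) (n : ℕ) : (L.sum chain).Theory :=
  {baseSentence U, subsetSentence L n, topSentence L (n + 1)} ∪
    {s | ∃ (k : ℕ) (f : L.Functions k), s = closedSentence n f} ∪
    {s | ∃ i ≤ n, s = stepSentence L i} ∪
    {s | ∃ ψ ∈ T, s = BoundedFormula.relativize LHom.sumInl (level L n) ψ}

theorem model_theory_iff (U : L.Relations 1) (T : L.Theory) (n : ℕ) :
    N ⊨ theory U T n ↔
      N ⊨ baseSentence U ∧ N ⊨ subsetSentence L n ∧ N ⊨ topSentence L (n + 1) ∧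
      (∀ (k : ℕ) (f : L.Functions k), N ⊨ closedSentence n f) ∧
      (∀ i ≤ n, N ⊨ stepSentence L i) ∧
      ∀ ψ ∈ T, N ⊨ (BoundedFormula.relativize LHom.sumInl (level L n) ψ :
        (L.sum chain).Sentence) := by
  simp only [theory, Theory.model_union_iff, Theory.model_iff (T := {s | _}),
    Theory.model_insert_iff, Theory.model_singleton_iff, Set.mem_ofPred_eq]
  constructor
  · rintro ⟨⟨⟨⟨h₁, h₀, h₂⟩, h₃⟩, h₄⟩, h₅⟩
    exact ⟨h₁, h₀, h₂, fun k f => h₃ _ ⟨k, f, rfl⟩, fun i hi => h₄ _ ⟨i, hi, rfl⟩,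
      fun ψ hψ => h₅ _ ⟨ψ, hψ, rfl⟩⟩
  · rintro ⟨h₁, h₀, h₂, h₃, h₄, h₅⟩
    refine ⟨⟨⟨⟨h₁, h₀, h₂⟩, ?_⟩, ?_⟩, ?_⟩
    · rintro _ ⟨k, f, rfl⟩
      exact h₃ k f
    · rintro _ ⟨i, hi, rfl⟩
      exact h₄ i hi
    · rintro _ ⟨ψ, hψ, rfl⟩
      exact h₅ ψ hψ

/-- The structure on `N` transporting `M` along an injection, with given levels and sections. -/
noncomputable abbrev expand {M N : Type} [L.Structure M] [Nonempty M] (ι : M → N)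
    (Q : ℕ → Set N) (F : ℕ → N → N → N) : (L.sum chain).Structure N where
  funMap := fun
    | Sum.inl f, xs => ι (Structure.funMap f (Function.invFun ι ∘ xs))
    | Sum.inr (ChainFunctions.sec i), xs => F i (xs 0) (xs 1)
  RelMap := fun
    | Sum.inl R, xs => ∃ ys, ι ∘ ys = xs ∧ Structure.RelMap R ys
    | Sum.inr (ChainRelations.level i), xs => xs 0 ∈ Q i

/-- A model of `T` of gap `n` expands to a model of the chain theory of gap `n + 1`. -/
theorem hasModelPair_theory {L : Language.{0, 0}} {U : L.Relations 1} {T : L.Theory}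
    {κ : Cardinal.{0}} {n : ℕ} (hκ : ℵ₀ ≤ κ) (hn : 1 ≤ n)
    (h : HasModelPair L U T (Order.succ^[n] κ) κ) :
    HasModelPair (L.sum chain) (base U) (theory U T n) (Order.succ^[n + 1] κ) κ := by
  obtain ⟨M, _, hT, hM, hU⟩ := h
  have hpos (k : ℕ) : ℵ₀ ≤ Order.succ^[k] κ := hκ.trans (Order.le_succ_iterate k κ)
  have : Nonempty M := mk_ne_zero_iff.1 (hM ▸ (aleph0_pos.trans_le (hpos n)).ne')
  obtain ⟨N, hN⟩ : ∃ N : Type, #N = Order.succ^[n + 1] κ := ⟨_, mk_out _⟩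
  have hmono : Monotone fun k => Order.succ^[k] κ := monotone_nat_of_le_succ fun k => by
    rw [Function.iterate_succ_apply']
    exact Order.le_succ _
  obtain ⟨ι⟩ : #M ≤ #N := by
    rw [hM, hN]
    exact hmono n.le_succ
  have hQ (k : ℕ) : ∃ S : Set N,
      (k = 0 → S = ι '' {x | Structure.RelMap U ![x]}) ∧ (k = n → S = Set.range ι) ∧
      (k = n + 1 → S = Set.univ) ∧ (k ≤ n + 1 → #S = Order.succ^[k] κ) := by
    by_cases h₀ : k = 0
    · subst h₀
      refine ⟨_, fun _ => rfl, by omega, by omega, fun _ => ?_⟩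
      rw [mk_image_eq ι.injective, hU, Function.iterate_zero_apply]
    by_cases h₁ : k = n
    · subst h₁
      refine ⟨_, by omega, fun _ => rfl, by omega, fun _ => ?_⟩
      rw [mk_range_eq ι ι.injective, hM]
    by_cases h₂ : k = n + 1
    · subst h₂
      refine ⟨_, by omega, by omega, fun _ => rfl, fun _ => ?_⟩
      rw [mk_univ, hN]
    by_cases h₃ : k ≤ n + 1
    · obtain ⟨S, hS⟩ := le_mk_iff_exists_set.1 ((hmono h₃).trans_eq hN.symm)
      exact ⟨S, by omega, by omega, by omega, fun _ => hS⟩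
    · exact ⟨∅, by omega, by omega, by omega, by omega⟩
  choose Q hQ₀ hQn hQtop hQcard using hQ
  have hF (k : ℕ) : ∃ F : N → N → N, k ≤ n → ∀ x ∈ Q (k + 1), ∀ y ∈ Q (k + 1),
      (∃ z ∈ Q k, F z x = y) ∨ ∃ z ∈ Q k, F z y = x := by
    by_cases hk : k ≤ n
    · obtain ⟨F, hF⟩ := exists_sections (A := Q k) (B := Q (k + 1))
        (by rw [hQcard k (by omega)]; exact hpos k)
        (by rw [hQcard k (by omega), hQcard (k + 1) (by omega), Function.iterate_succ_apply'])
      exact ⟨F, fun _ => hF⟩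
    · exact ⟨fun z _ => z, fun h => absurd h hk⟩
  choose F hF using hF
  let _ : (L.sum chain).Structure N := expand ι Q F
  let _ : L.Structure N := (LHom.sumInl : L →ᴸ L.sum chain).reduct N
  have hrel {k : ℕ} (R : L.Relations k) (xs : Fin k → N) :
      Structure.RelMap (L := L.sum chain) (Sum.inl R) xs ↔
        ∃ ys, ι ∘ ys = xs ∧ Structure.RelMap R ys := Iff.rfl
  have hUset : {x : N | Structure.RelMap (base U) ![x]} =
      ι '' {x | Structure.RelMap U ![x]} := by
    ext x
    simp only [Set.mem_ofPred_eq, base, hrel, Set.mem_image]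
    constructor
    · rintro ⟨ys, h, hys⟩
      refine ⟨ys 0, ?_, congrFun h 0⟩
      rwa [show ![ys 0] = ys from funext fun i => by fin_cases i; rfl]
    · rintro ⟨y, hy, rfl⟩
      exact ⟨![y], funext fun i => by fin_cases i; rfl, hy⟩
  have hlevel (i : ℕ) : levelSet L N i = Q i := rfl
  let j : M ↪[L] N :=
    { ι with
      inj' := ι.injective
      map_fun' := fun f xs => by
        change _ = ι (Structure.funMap f (Function.invFun ι ∘ ι ∘ xs))
        rw [← Function.comp_assoc, Function.invFun_comp ι.injective]
        rfl
      map_rel' := fun R xs => by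
        change (∃ ys, ι ∘ ys = ι ∘ xs ∧ Structure.RelMap R ys) ↔ _
        simp [ι.injective.comp_left.eq_iff] }
  refine ⟨N, inferInstance, (model_theory_iff U T n).2 ⟨?_, ?_, ?_, ?_, ?_, ?_⟩, hN, ?_⟩
  · rw [realize_baseSentence, hlevel, hQ₀ 0 rfl, hUset]
  · rw [realize_subsetSentence, hlevel, hlevel, hQ₀ 0 rfl, hQn n rfl]
    exact Set.image_subset_range _ _
  · rw [realize_topSentence, hlevel, hQtop _ rfl]
  · intro k f
    rw [realize_closedSentence, hlevel, hQn n rfl]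
    exact fun xs => ⟨_, rfl⟩
  · intro i hi
    rw [realize_stepSentence]
    exact hF i hi
  · intro ψ hψ
    have hψN := (BoundedFormula.realize_relativize LHom.sumInl (level L n) j
      (fun x => show x ∈ Q n ↔ _ by rw [hQn n rfl]; rfl) ψ default default).2
      (Theory.realize_sentence_of_mem T hψ)
    rwa [Unique.eq_default (j ∘ _), Unique.eq_default (j ∘ _)] at hψN
  · rw [hUset, mk_image_eq ι.injective, hU]

/-- Level `n` of a model of the chain theory of gap `n + 1` is a model of `T` of gap `n`. -/
theorem hasModelPair_of_theory {L : Language.{0, 0}} {U : L.Relations 1} {T : L.Theory}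
    {lam : Cardinal.{0}} {n : ℕ} (hlam : ℵ₀ ≤ lam) (hn : 1 ≤ n)
    (h : HasModelPair (L.sum chain) (base U) (theory U T n) (Order.succ^[n + 1] lam) lam) :
    HasModelPair L U T (Order.succ^[n] lam) lam := by
  obtain ⟨N, _, hT, hN, hU⟩ := h
  obtain ⟨hbase, hsub, htop, hclosed, hstep, hψ⟩ := (model_theory_iff U T n).1 hT
  rw [realize_baseSentence] at hbase
  rw [realize_topSentence] at htop
  have hle (k : ℕ) (hk : k ≤ n + 1) : #(levelSet L N k) ≤ Order.succ^[k] lam := by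
    induction k with
    | zero => rw [hbase, hU, Function.iterate_zero_apply]
    | succ k ih =>
      rw [Function.iterate_succ_apply']
      exact mk_le_succ_of_sections (F := fun z x => Structure.funMap (sec L k) ![z, x])
        (hlam.trans (Order.le_succ_iterate k lam)) (ih (by omega))
        ((realize_stepSentence k).1 (hstep k (by omega)))
  have hcard : #(levelSet L N n) = Order.succ^[n] lam := by
    refine (hle n n.le_succ).antisymm ?_
    by_contra! hlt
    obtain ⟨m, rfl⟩ := Nat.exists_eq_add_of_le' hn
    rw [Function.iterate_succ_apply', Order.lt_succ_iff] at hlt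
    have htopcard := mk_le_succ_of_sections
      (F := fun z x => Structure.funMap (sec L (m + 1)) ![z, x])
      (hlam.trans (Order.le_succ_iterate m lam)) hlt
      ((realize_stepSentence (m + 1)).1 (hstep (m + 1) le_rfl))
    rw [htop, mk_univ, hN, Function.iterate_succ_apply',
      Function.iterate_succ_apply'] at htopcard
    exact (Order.lt_succ _).not_ge htopcard
  let _ : L.Structure N := (LHom.sumInl : L →ᴸ L.sum chain).reduct N
  let S : L.Substructure N :=
    { carrier := levelSet L N n
      fun_mem := fun f xs _ => (realize_closedSentence n f).1 (hclosed _ f) xs }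
  refine ⟨S, inferInstance, (Theory.model_iff T).2 fun ψ hψT => ?_, hcard, ?_⟩
  · have hψN := hψ ψ hψT
    rw [Sentence.Realize, Formula.Realize] at hψN
    rw [Sentence.Realize, Formula.Realize,
      ← BoundedFormula.realize_relativize LHom.sumInl (level L n) S.subtype]
    · rwa [Unique.eq_default (S.subtype ∘ _), Unique.eq_default (S.subtype ∘ _)]
    · intro x
      constructor
      · exact fun hx => ⟨⟨x, hx⟩, rfl⟩
      · rintro ⟨y, rfl⟩
        exact y.2
  · have hU_iff (y : S) : Structure.RelMap U ![y] ↔ Structure.RelMap (base U) ![(y : N)] := by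
      rw [← S.subtype.map_rel]
      change Structure.RelMap (base U) _ ↔ _
      rw [show S.subtype ∘ ![y] = ![(y : N)] from funext fun i => by fin_cases i; rfl]
    rw [← mk_image_eq Subtype.val_injective, ← hU]
    congr 2
    ext x
    constructor
    · rintro ⟨y, hy, rfl⟩
      exact (hU_iff y).1 hy
    · intro hx
      have hxn : x ∈ levelSet L N n := by
        rw [realize_subsetSentence] at hsub
        exact hsub (hbase ▸ hx)
      exact ⟨⟨x, hxn⟩, (hU_iff ⟨x, hxn⟩).2 hx, rfl⟩

end chain

end FirstOrder.Language

/-- for every `n ≥ 1`, the gap-`(n+1)` cardinal transfer principle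
implies the gap-`n` cardinal transfer principle. -/
theorem stmt1 (n : ℕ) (hn : 1 ≤ n) (h : GapTransfer (n + 1)) : GapTransfer n := by
  intro κ lam hκ hlam L U T hL hT
  exact Language.chain.hasModelPair_of_theory hlam hn
    (h κ lam hκ hlam _ _ _ (Language.card_sum_chain_le hL)
      (Language.chain.hasModelPair_theory hκ hn hT))
end

section
/- If for some fixed n ≥ 1 both transfer principles (ℵ_{n}, ℵ₀) → (ℵ_{n+1}, ℵ₁) and (ℵ_{n+1}, ℵ₁) → (ℵ_{n}, ℵ₀) fail, then for every m ≥ n both (ℵ_{m}, ℵ₀) → (ℵ_{m+1}, ℵ₁) and (ℵ_{m+1}, ℵ₁) → (ℵ_{m}, ℵ₀) fail. -/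
open FirstOrder Cardinal

/-- The transfer principle `(κ, lam) → (κ', lam')`. -/
def Transfer (κ lam κ' lam' : Cardinal.{0}) : Prop :=
  ∀ (L : FirstOrder.Language.{0,0}) (U : L.Relations 1) (T : L.Theory), L.card ≤ ℵ₀ →
    HasModelPair L U T κ lam → HasModelPair L U T κ' lam'

/-- The two extra function symbols of the gap-lifting language: a retraction onto a distinguished
subset, and a binary function whose sections enumerate initial segments by that subset. -/
inductive GapFunctions : ℕ → Type
  | retract : GapFunctions 1
  | enum : GapFunctions 2

instance (n : ℕ) : Subsingleton (GapFunctions n) :=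
  ⟨by rintro ⟨⟩ ⟨⟩ <;> rfl⟩

namespace FirstOrder.Language

/-- The language of the symbols in `GapFunctions`. -/
def gapSymbols : Language.{0, 0} := ⟨GapFunctions, fun _ => Empty⟩

/-- The expansion of `L` by the symbols in `GapFunctions`. -/
abbrev gap (L : Language.{0, 0}) : Language.{0, 0} := L.sum gapSymbols

theorem card_gapSymbols_le : gapSymbols.card ≤ ℵ₀ := by
  have (n : ℕ) : Countable (gapSymbols.Functions n) :=
    inferInstanceAs (Countable (GapFunctions n))
  have (n : ℕ) : Countable (gapSymbols.Relations n) :=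
    inferInstanceAs (Countable Empty)
  exact Cardinal.mk_le_aleph0_iff.2 (inferInstanceAs (Countable (_ ⊕ _)))

variable {L : Language.{0, 0}}

theorem card_gap_le (hL : L.card ≤ ℵ₀) : L.gap.card ≤ ℵ₀ := by
  rw [card_sum, lift_id, lift_id]
  exact Cardinal.add_le_aleph0.2 ⟨hL, card_gapSymbols_le⟩

/-- The symbol of the retraction. -/
abbrev retractFn : L.gap.Functions 1 := Sum.inr GapFunctions.retract

/-- The symbol of the enumeration. -/
abbrev enumFn : L.gap.Functions 2 := Sum.inr GapFunctions.enum

/-- A relation symbol of `L` as a symbol of the expansion. -/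
abbrev gapRel {n : ℕ} (R : L.Relations n) : L.gap.Relations n := Sum.inl R

/-- Relativization of a term to the range of the retraction. -/
def gapTerm {α : Type} : L.Term α → L.gap.Term α
  | .var a => retractFn.apply₁ (.var a)
  | .func f ts => retractFn.apply₁ (.func (Sum.inl f) fun i => gapTerm (ts i))

/-- Relativization of a formula to the range of the retraction. -/
def gapFormula {α : Type} {n : ℕ} (φ : L.BoundedFormula α n) : L.gap.BoundedFormula α n :=
  φ.mapTermRel (g := id) (fun _ => gapTerm) (fun _ => gapRel) fun _ => id

/-- The `L`-structure `M` is, through the injection `e : M → N`, the range of the retraction `e ∘ g`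
of the `L.gap`-structure `N`. -/
structure IsCore (L : Language.{0, 0}) {M N : Type} [L.Structure M] [L.gap.Structure N]
    (e : M → N) (g : N → M) : Prop where
  injective : Function.Injective e
  surjective : Function.Surjective g
  retract (x : N) : Structure.funMap (retractFn (L := L)) ![x] = e (g x)
  func {n : ℕ} (f : L.Functions n) (xs : Fin n → M) :
    g (Structure.funMap (L := L.gap) (Sum.inl f) (e ∘ xs)) = Structure.funMap f xs
  rel {n : ℕ} (R : L.Relations n) (xs : Fin n → M) :
    Structure.RelMap (gapRel R) (e ∘ xs) ↔ Structure.RelMap R xs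

namespace IsCore

variable {M N : Type} [L.Structure M] [L.gap.Structure N] {e : M → N} {g : N → M}

theorem realize_gapTerm (h : IsCore L e g) {α : Type} (t : L.Term α) (v : α → N) :
    (gapTerm t).realize v = e (t.realize (g ∘ v)) := by
  induction t with
  | var a => simp [gapTerm, h.retract]
  | func f ts ih =>
    rw [gapTerm, Term.realize_functions_apply₁, h.retract]
    simp only [Term.realize, ih, ← h.func]
    rfl

theorem realize_gapFormula (h : IsCore L e g) {α : Type} {n : ℕ} (φ : L.BoundedFormula α n)
    (v : α → N) (xs : Fin n → N) :
    (gapFormula φ).Realize v xs ↔ φ.Realize (g ∘ v) (g ∘ xs) := by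
  induction φ with
  | falsum => rfl
  | equal t₁ t₂ =>
    change (gapTerm t₁).realize _ = (gapTerm t₂).realize _ ↔ t₁.realize _ = t₂.realize _
    rw [h.realize_gapTerm, h.realize_gapTerm, h.injective.eq_iff, Sum.comp_elim]
  | rel R ts =>
    change Structure.RelMap (gapRel R) (fun i => (gapTerm (ts i)).realize _) ↔
      Structure.RelMap R fun i => (ts i).realize _
    simp only [h.realize_gapTerm, Sum.comp_elim]
    exact h.rel R _
  | imp φ ψ ihφ ihψ => exact imp_congr (ihφ xs) (ihψ xs)
  | all φ ih =>
    refine (forall_congr' fun x => ih (Fin.snoc xs x)).trans ?_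
    simp only [Fin.comp_snoc]
    exact (h.surjective.forall (p := fun y => φ.Realize (g ∘ v) (Fin.snoc (g ∘ xs) y))).symm

theorem realize_gapSentence (h : IsCore L e g) (φ : L.Sentence) :
    N ⊨ gapFormula φ ↔ M ⊨ φ := by
  refine (h.realize_gapFormula φ default default).trans ?_
  rw [Subsingleton.elim (g ∘ default) default, Subsingleton.elim (g ∘ default) default]
  rfl

end IsCore

/-- The sentence saying that `U` holds only of fixed points of the retraction. -/
def gapFixed (U : L.Relations 1) : L.gap.Sentence :=
  ∀' (Relations.boundedFormula₁ (gapRel U) (&0) ⟹ (retractFn.apply₁ (&0) =' &0))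

/-- The sentence saying that of any two points, one is enumerated by the other over the range of
the retraction. -/
def gapEnum (L : Language.{0, 0}) : L.gap.Sentence :=
  ∀' ∀' ∃' ((enumFn.apply₂ (&0) (retractFn.apply₁ (&2)) =' &1) ⊔
    (enumFn.apply₂ (&1) (retractFn.apply₁ (&2)) =' &0))

section

variable {N : Type} [L.gap.Structure N]

theorem realize_gapFixed (U : L.Relations 1) :
    N ⊨ gapFixed U ↔ ∀ x : N, Structure.RelMap (gapRel U) ![x] →
      Structure.funMap (retractFn (L := L)) ![x] = x := by
  simp [gapFixed, Sentence.Realize, Formula.Realize, BoundedFormula.realize_rel₁, Fin.snoc]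

theorem realize_gapEnum :
    N ⊨ gapEnum L ↔ ∀ x y : N, ∃ z : N,
      Structure.funMap (enumFn (L := L)) ![x, Structure.funMap (retractFn (L := L)) ![z] ] = y ∨
      Structure.funMap (enumFn (L := L)) ![y, Structure.funMap (retractFn (L := L)) ![z] ] = x := by
  simp [gapEnum, Sentence.Realize, Formula.Realize, Fin.snoc]

end

/-- The theory of the expansions whose retraction has a model of `T` as range, containing `U`, and
whose enumeration bounds the cardinality by the successor of that of the range. -/
def gapTheory (U : L.Relations 1) (T : L.Theory) : L.gap.Theory :=
  gapFormula '' T ∪ {gapFixed U, gapEnum L}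

theorem IsCore.model_gapTheory_iff {M N : Type} [L.Structure M] [L.gap.Structure N] {e : M → N}
    {g : N → M} (h : IsCore L e g) (U : L.Relations 1) (T : L.Theory) :
    N ⊨ gapTheory U T ↔ M ⊨ T ∧ N ⊨ gapFixed U ∧ N ⊨ gapEnum L := by
  simp only [Theory.model_iff, gapTheory, Set.mem_union, Set.mem_image, Set.mem_insert_iff,
    Set.mem_singleton_iff, or_imp, forall_and, forall_eq, forall_exists_index, and_imp,
    forall_apply_eq_imp_iff₂, h.realize_gapSentence]

end FirstOrder.Language

theorem Function.comp_vec_one {α β : Type*} (f : α → β) (a : α) : f ∘ ![a] = ![f a] :=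
  funext fun i => by rw [Subsingleton.elim i 0]; rfl

theorem Cardinal.le_mk_of_forall_exists_eq_or_eq {N V : Type} {κ : Cardinal.{0}} (hκ : ℵ₀ ≤ κ)
    (hN : κ < #N) (F : N → V → N) (h : ∀ x y, ∃ z, F x z = y ∨ F y z = x) : κ ≤ #V := by
  by_contra! hV
  obtain ⟨A, hA⟩ := le_mk_iff_exists_set.1 hN.le
  have hB : #(Set.range fun p : A × V => F p.1 p.2) < #N := by
    refine (mk_range_le.trans ?_).trans_lt hN
    rw [mk_prod, Cardinal.lift_id, Cardinal.lift_id, hA]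
    exact mul_le_of_le hκ le_rfl hV.le
  obtain ⟨z, hz⟩ : ∃ z, z ∉ Set.range fun p : A × V => F p.1 p.2 := by
    by_contra! hz
    rw [Set.eq_univ_of_forall hz, mk_univ] at hB
    exact hB.false
  have hAz : A ⊆ Set.range (F z) := by
    intro a ha
    obtain ⟨w, hw | hw⟩ := h z a
    · exact ⟨w, hw⟩
    · exact absurd ⟨(⟨a, ha⟩, w), hw⟩ hz
  exact ((hA.symm.trans_le (mk_le_mk_of_subset hAz)).trans mk_range_le).not_gt hV

theorem Cardinal.exists_forall_exists_eq_or_eq {M : Type} (hM : ℵ₀ ≤ #M) :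
    ∃ F : (Order.succ #M).ord.ToType → M → (Order.succ #M).ord.ToType,
      ∀ x y, ∃ z, F x z = y ∨ F y z = x := by
  have key (x : (Order.succ #M).ord.ToType) : ∃ f : M → Set.Iic x, Function.Surjective f := by
    have hx : #(Set.Iio x) ≤ #M := by
      have := mk_Iio_lt x (by simp)
      rwa [mk_ord_toType, Order.lt_succ_iff] at this
    have hx' : #(Set.Iic x) ≤ #M := by
      rw [← Set.Iio_insert]
      exact mk_insert_le.trans (add_le_of_le hM hx (one_le_aleph0.trans hM))
    obtain ⟨f⟩ := hx'
    exact ⟨Function.invFun f, Function.invFun_surjective f.injective⟩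
  choose f hf using key
  refine ⟨fun x z => f x z, fun x y => ?_⟩
  obtain hxy | hxy := le_total y x
  · obtain ⟨z, hz⟩ := hf x ⟨y, hxy⟩
    exact ⟨z, Or.inl (congrArg Subtype.val hz)⟩
  · obtain ⟨z, hz⟩ := hf y ⟨x, hxy⟩
    exact ⟨z, Or.inr (congrArg Subtype.val hz)⟩

open Language Order

variable {L : FirstOrder.Language.{0, 0}} {U : L.Relations 1} {T : L.Theory}

theorem HasModelPair.gap {κ lam : Cardinal.{0}} (hκ : ℵ₀ ≤ κ) (h : HasModelPair L U T κ lam) :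
    HasModelPair L.gap (gapRel U) (gapTheory U T) (succ κ) lam := by
  obtain ⟨M, _, hT, rfl, hU⟩ := h
  obtain ⟨F, hF⟩ := exists_forall_exists_eq_or_eq hκ
  have : Nonempty M := mk_ne_zero_iff.1 (aleph0_pos.trans_le hκ).ne'
  let N := (succ #M).ord.ToType
  obtain ⟨e⟩ : #M ≤ #N := (le_succ _).trans_eq (mk_ord_toType _).symm
  have hge : Function.LeftInverse (Function.invFun e) e := Function.leftInverse_invFun e.injective
  generalize Function.invFun e = g at hge
  let _ : L.gap.Structure N :=
    { funMap := fun {n} f xs => match n, f, xs with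
        | _, Sum.inl f, xs => e (Structure.funMap f (g ∘ xs))
        | _, Sum.inr GapFunctions.retract, xs => e (g (xs 0))
        | _, Sum.inr GapFunctions.enum, xs => F (xs 0) (g (xs 1))
      RelMap := fun {n} R xs => match R with
        | Sum.inl R => ∃ ys, xs = e ∘ ys ∧ Structure.RelMap R ys
        | Sum.inr R => R.elim }
  have hcore : IsCore L e g :=
    { injective := e.injective
      surjective := hge.surjective
      retract := fun x => rfl
      func := fun f xs => by
        change g (e (Structure.funMap f (g ∘ e ∘ xs))) = _
        rw [hge, ← Function.comp_assoc, hge.comp_eq_id, Function.id_comp]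
      rel := fun R xs => by
        change (∃ ys, e ∘ xs = e ∘ ys ∧ Structure.RelMap R ys) ↔ _
        simp [e.injective.comp_left.eq_iff] }
  have hUe (x : N) : Structure.RelMap (gapRel U) ![x] ↔
      ∃ y, e y = x ∧ Structure.RelMap U ![y] := by
    change (∃ ys, ![x] = e ∘ ys ∧ Structure.RelMap U ys) ↔ _
    constructor
    · rintro ⟨ys, hx, hys⟩
      obtain ⟨y, rfl⟩ : ∃ y, ys = ![y] := ⟨ys 0, funext fun i => by rw [Subsingleton.elim i 0]; rfl⟩
      exact ⟨y, (congrFun hx 0).symm, hys⟩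
    · rintro ⟨y, rfl, hy⟩
      exact ⟨![y], (Function.comp_vec_one e y).symm, hy⟩
  refine ⟨N, inferInstance, (hcore.model_gapTheory_iff U T).2 ⟨hT, ?_, ?_⟩, mk_ord_toType _, ?_⟩
  · refine (realize_gapFixed U).2 fun x hx => ?_
    obtain ⟨y, rfl, -⟩ := (hUe x).1 hx
    exact congrArg e (hge y)
  · refine realize_gapEnum.2 fun x y => ?_
    obtain ⟨z, hz⟩ := hF x y
    refine ⟨e z, ?_⟩
    change F x (g (e (g (e z)))) = y ∨ F y (g (e (g (e z)))) = x
    rwa [hge, hge]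
  · rw [← hU, ← mk_image_eq e.injective]
    congr 2
    ext x
    simp [hUe, and_comm]

theorem HasModelPair.of_gap {κ lam : Cardinal.{0}} (hL : L.card ≤ ℵ₀) (hκ : ℵ₀ ≤ κ)
    (hlam : lam ≤ κ) (h : HasModelPair L.gap (gapRel U) (gapTheory U T) (succ κ) lam) :
    HasModelPair L U T κ lam := by
  obtain ⟨N, _, hT, hN, hU⟩ := h
  let r : N → N := fun x => Structure.funMap (retractFn (L := L)) ![x]
  let _ : L.Structure (Set.range r) :=
    { funMap := fun f xs => Set.rangeFactorization r
        (Structure.funMap (L := L.gap) (Sum.inl f) (Subtype.val ∘ xs))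
      RelMap := fun R xs => Structure.RelMap (gapRel R) (Subtype.val ∘ xs) }
  have hcore : IsCore L (Subtype.val : Set.range r → N) (Set.rangeFactorization r) :=
    { injective := Subtype.val_injective
      surjective := Set.rangeFactorization_surjective
      retract := fun _ => rfl
      func := fun _ _ => rfl
      rel := fun _ _ => Iff.rfl }
  obtain ⟨hM, hfix, henum⟩ := (hcore.model_gapTheory_iff U T).1 hT
  rw [realize_gapFixed] at hfix
  rw [realize_gapEnum] at henum
  have hUr (y : Set.range r) : Structure.RelMap U ![y] ↔
      Structure.RelMap (gapRel U) ![y.1] := by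
    change Structure.RelMap (gapRel U) (Subtype.val ∘ ![y]) ↔ _
    rw [Function.comp_vec_one]
  have hUV : #{y : Set.range r | Structure.RelMap U ![y]} = lam := by
    rw [← hU, ← mk_image_eq Subtype.val_injective]
    congr 2
    ext x
    simp only [hUr, Set.mem_image, Set.mem_ofPred_eq]
    exact ⟨by rintro ⟨y, hy, rfl⟩; exact hy, fun hx => ⟨⟨x, x, hfix x hx⟩, hx, rfl⟩⟩
  have hV : κ ≤ #(Set.range r) := by
    refine le_mk_of_forall_exists_eq_or_eq hκ ((lt_succ κ).trans_eq hN.symm)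
      (fun x y => Structure.funMap (enumFn (L := L)) ![x, y.1]) fun x y => ?_
    obtain ⟨z, hz⟩ := henum x y
    exact ⟨⟨r z, z, rfl⟩, hz⟩
  obtain ⟨S, hS, hSκ⟩ := exists_elementarySubstructure_card_eq L
    {y : Set.range r | Structure.RelMap U ![y]} κ hκ (by simpa [hUV] using hlam)
    (by simpa using hL.trans hκ) (by simpa using hV)
  refine ⟨S, inferInstance, (S.theory_model_iff T).2 hM, by simpa using hSκ, ?_⟩
  rw [← hUV, ← mk_image_eq (Subtype.val_injective (p := (· ∈ S)))]
  congr 2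
  ext x
  have hSx (y : S) : Structure.RelMap U ![y] ↔ Structure.RelMap U ![y.1] := by
    rw [← S.subtype.map_rel, Function.comp_vec_one, ElementarySubstructure.subtype_apply]
  exact ⟨by rintro ⟨y, hy, rfl⟩; exact (hSx y).1 hy, fun hx => ⟨⟨x, hS hx⟩, (hSx _).2 hx, rfl⟩⟩

theorem Transfer.of_succ {κ lam κ' lam' : Cardinal.{0}} (hκ : ℵ₀ ≤ κ) (hκ' : ℵ₀ ≤ κ')
    (hlam : lam' ≤ κ') (h : Transfer (succ κ) lam (succ κ') lam') : Transfer κ lam κ' lam' :=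
  fun L U T hL hT => (h L.gap (gapRel U) (gapTheory U T) (card_gap_le hL) (hT.gap hκ)).of_gap
    hL hκ' hlam

/-- if for some `n ≥ 1` both transfer principles
`(ℵ_n, ℵ₀) → (ℵ_{n+1}, ℵ₁)` and `(ℵ_{n+1}, ℵ₁) → (ℵ_n, ℵ₀)` fail, then for every
`m ≥ n` both `(ℵ_m, ℵ₀) → (ℵ_{m+1}, ℵ₁)` and `(ℵ_{m+1}, ℵ₁) → (ℵ_m, ℵ₀)` fail. -/
theorem stmt16 (n : ℕ) (hn : 1 ≤ n)
    (h1 : ¬ Transfer (aleph n) (aleph 0) (aleph (n + 1)) (aleph 1))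
    (h2 : ¬ Transfer (aleph (n + 1)) (aleph 1) (aleph n) (aleph 0)) :
    ∀ m : ℕ, n ≤ m →
      ¬ Transfer (aleph m) (aleph 0) (aleph (m + 1)) (aleph 1) ∧
      ¬ Transfer (aleph (m + 1)) (aleph 1) (aleph m) (aleph 0) := by
  intro m hm
  induction m, hm using Nat.le_induction with
  | base => exact ⟨h1, h2⟩
  | succ m hm ih =>
    have h0 : aleph 0 ≤ aleph m := aleph_le_aleph.2 (by simp)
    have h1 : aleph 1 ≤ aleph (m + 1) := aleph_le_aleph.2 (by simp)
    rw [Nat.cast_add, Nat.cast_one, ← succ_aleph (m + 1), ← succ_aleph m]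
    rw [← succ_aleph m] at h1 ih
    exact ⟨fun h => ih.1 (h.of_succ (aleph0_le_aleph _) ((aleph0_le_aleph _).trans (le_succ _)) h1),
      fun h => ih.2 (h.of_succ ((aleph0_le_aleph _).trans (le_succ _)) (aleph0_le_aleph _) h0)⟩
end

section
/- For any infinite cardinal β, if there exists a β⁺-Kurepa tree then there is a first-order structure of cardinality β⁺⁺ in a countable language with a unary predicate U interpreted by a set of size β, encoding the tree together with β⁺⁺ of its branches; conversely from such a structure (satisfying the natural axioms asserting the tree structure and that branches are distinct cofinal chains) one recovers a β⁺-Kurepa tree. Hence the existence of a (β⁺⁺, β)-model of the corresponding sentence φ_KH is equivalent to the existence of a β⁺-Kurepa tree. -/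
open Cardinal Set

/-- The restriction of `<` to the set of predecessors of `t`. -/
def predRel {T : Type*} [PartialOrder T] (t : T) : Set.Iio t → Set.Iio t → Prop :=
  fun a b => (a : T) < (b : T)

/-- A set-theoretic tree: a partial order in which the predecessors of every point are
well-ordered. -/
structure STree : Type 1 where
  carrier : Type
  [po : PartialOrder carrier]
  wo : ∀ t : carrier, IsWellOrder (Set.Iio t) (predRel t)

attribute [instance] STree.po

/-- The height (level) of a node: the order type of its set of predecessors. -/
noncomputable def STree.ht (S : STree) (t : S.carrier) : Ordinal.{0} :=
  @Ordinal.type _ (predRel t) (S.wo t)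

/-- The `α`-th level of the tree. -/
def STree.Level (S : STree) (α : Ordinal.{0}) : Set S.carrier := {t | S.ht t = α}

/-- A cofinal branch of length `h`: a chain meeting every level `α < h`. -/
def STree.IsCofinalBranch (S : STree) (h : Ordinal.{0}) (b : Set S.carrier) : Prop :=
  IsChain (· ≤ ·) b ∧ ∀ α < h, ∃ t ∈ b, t ∈ S.Level α

/-- `S` is a `β⁺`-Kurepa tree: a tree of height `β⁺` all of whose levels are nonempty of
cardinality at most `β`, with at least `β⁺⁺` cofinal branches. -/
def IsKurepaTree (β : Cardinal.{0}) (S : STree) : Prop :=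
  (∀ t : S.carrier, S.ht t < (Order.succ β).ord) ∧
  (∀ α < (Order.succ β).ord, (S.Level α).Nonempty ∧ #(S.Level α) ≤ β) ∧
  Order.succ (Order.succ β) ≤ #{b : Set S.carrier | S.IsCofinalBranch (Order.succ β).ord b}

open FirstOrder

namespace KurepaCode

section Sentence

open FirstOrder Language

/-- The two binary function symbols: one for injections of initial segments, one for coding
the nodes on branches. -/
inductive Fn : ℕ → Type
  | inj : Fn 2
  | code : Fn 2

/-- The relation symbols: a small set `U`, a set `P` of levels and a linear order. -/
inductive Rel : ℕ → Type
  | small : Rel 1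
  | levels : Rel 1
  | lt : Rel 2

/-- The language of coded Kurepa trees. -/
def language : FirstOrder.Language.{0, 0} := ⟨Fn, Rel⟩

abbrev small : language.Relations 1 := Rel.small
abbrev levels : language.Relations 1 := Rel.levels
abbrev lt : language.Relations 2 := Rel.lt
abbrev inj : language.Functions 2 := Fn.inj
abbrev code : language.Functions 2 := Fn.code

theorem card_language_le : language.card ≤ ℵ₀ := by
  have h₁ : Function.Injective (fun f : Σ n, Fn n => match f with
      | ⟨_, .inj⟩ => 0
      | ⟨_, .code⟩ => 1) := by
    rintro ⟨_, _ | _⟩ ⟨_, _ | _⟩ h <;> simp_all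
  have h₂ : Function.Injective (fun f : Σ n, Rel n => match f with
      | ⟨_, .small⟩ => 0
      | ⟨_, .levels⟩ => 1
      | ⟨_, .lt⟩ => 2) := by
    rintro ⟨_, _ | _⟩ ⟨_, _ | _⟩ h <;> simp_all
  have := h₁.countable
  have := h₂.countable
  have : Countable language.Symbols :=
    inferInstanceAs (Countable ((Σ n, Fn n) ⊕ (Σ n, Rel n)))
  exact mk_le_aleph0

/-- The order `r` is linear, `g` injects its initial segments into `P`, and into `U` below points
of `P`; the maps `c p`, for `p` in `P`, take values in `U`, become finer as `p` increases, and
jointly separate points. -/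
structure IsModel {M : Type} (r : M → M → Prop) (U P : Set M) (g c : M → M → M) : Prop where
  irrefl : ∀ x, ¬ r x x
  trans : ∀ x y z, r x y → r y z → r x z
  trichotomous : ∀ x y, (r x y ∨ x = y) ∨ r y x
  inj : ∀ x y z, r y x → r z x → g x y = g x z → y = z
  inj_mem : ∀ x y, r y x → g x y ∈ P
  inj_mem_small : ∀ x y, x ∈ P → r y x → g x y ∈ U
  code_mem : ∀ p x, p ∈ P → c p x ∈ U
  coherent : ∀ p q x y, p ∈ P → q ∈ P → r p q → c q x = c q y → c p x = c p y
  separates : ∀ x y, x ≠ y → ∃ p, p ∈ P ∧ c p x ≠ c p y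

/-- The sentence expressing `IsModel`. -/
def sentence : language.Sentence :=
  (∀' ∼(lt.boundedFormula₂ (&0) (&0))) ⊓
  ((∀' ∀' ∀' (lt.boundedFormula₂ (&0) (&1) ⟹ lt.boundedFormula₂ (&1) (&2) ⟹
    lt.boundedFormula₂ (&0) (&2))) ⊓
  ((∀' ∀' (lt.boundedFormula₂ (&0) (&1) ⊔ (&0) =' (&1) ⊔ lt.boundedFormula₂ (&1) (&0))) ⊓
  ((∀' ∀' ∀' (lt.boundedFormula₂ (&1) (&0) ⟹ lt.boundedFormula₂ (&2) (&0) ⟹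
    (inj.apply₂ (&0) (&1) =' inj.apply₂ (&0) (&2)) ⟹ (&1) =' (&2))) ⊓
  ((∀' ∀' (lt.boundedFormula₂ (&1) (&0) ⟹ levels.boundedFormula₁ (inj.apply₂ (&0) (&1)))) ⊓
  ((∀' ∀' (levels.boundedFormula₁ (&0) ⟹ lt.boundedFormula₂ (&1) (&0) ⟹
    small.boundedFormula₁ (inj.apply₂ (&0) (&1)))) ⊓
  ((∀' ∀' (levels.boundedFormula₁ (&0) ⟹ small.boundedFormula₁ (code.apply₂ (&0) (&1)))) ⊓
  ((∀' ∀' ∀' ∀' (levels.boundedFormula₁ (&0) ⟹ levels.boundedFormula₁ (&1) ⟹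
    lt.boundedFormula₂ (&0) (&1) ⟹ (code.apply₂ (&1) (&2) =' code.apply₂ (&1) (&3)) ⟹
    (code.apply₂ (&0) (&2) =' code.apply₂ (&0) (&3)))) ⊓
  (∀' ∀' (∼((&0) =' (&1)) ⟹ ∃' (levels.boundedFormula₁ (&2) ⊓
    ∼(code.apply₂ (&2) (&0) =' code.apply₂ (&2) (&1))))))))))))

theorem realize_sentence (M : Type) [language.Structure M] :
    M ⊨ sentence ↔ IsModel (fun x y : M => Structure.RelMap lt ![x, y])
      {x | Structure.RelMap small ![x]} {x | Structure.RelMap levels ![x]}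
      (fun x y => Structure.funMap inj ![x, y]) (fun x y => Structure.funMap code ![x, y]) := by
  constructor
  · intro h
    simp only [sentence, Sentence.Realize, Formula.Realize, BoundedFormula.realize_inf] at h
    obtain ⟨h₁, h₂, h₃, h₄, h₅, h₆, h₇, h₈, h₉⟩ := h
    constructor
    · simpa [BoundedFormula.realize_rel₂, Fin.snoc] using h₁
    · simpa [BoundedFormula.realize_rel₂, Fin.snoc] using h₂
    · simpa [BoundedFormula.realize_rel₂, Fin.snoc] using h₃
    · simpa [BoundedFormula.realize_rel₂, Fin.snoc] using h₄
    · simpa [BoundedFormula.realize_rel₁, BoundedFormula.realize_rel₂, Fin.snoc] using h₅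
    · simpa [BoundedFormula.realize_rel₁, BoundedFormula.realize_rel₂, Fin.snoc] using h₆
    · simpa [BoundedFormula.realize_rel₁, Fin.snoc] using h₇
    · simpa [BoundedFormula.realize_rel₁, BoundedFormula.realize_rel₂, Fin.snoc] using h₈
    · simpa [BoundedFormula.realize_rel₁, Fin.snoc] using h₉
  · rintro ⟨h₁, h₂, h₃, h₄, h₅, h₆, h₇, h₈, h₉⟩
    simp only [sentence, Sentence.Realize, Formula.Realize, BoundedFormula.realize_inf]
    refine ⟨?_, ?_, ?_, ?_, ?_, ?_, ?_, ?_, ?_⟩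
    · simpa [BoundedFormula.realize_rel₂, Fin.snoc] using h₁
    · simpa [BoundedFormula.realize_rel₂, Fin.snoc] using h₂
    · simpa [BoundedFormula.realize_rel₂, Fin.snoc] using h₃
    · simpa [BoundedFormula.realize_rel₂, Fin.snoc] using h₄
    · simpa [BoundedFormula.realize_rel₁, BoundedFormula.realize_rel₂, Fin.snoc] using h₅
    · simpa [BoundedFormula.realize_rel₁, BoundedFormula.realize_rel₂, Fin.snoc] using h₆
    · simpa [BoundedFormula.realize_rel₁, Fin.snoc] using h₇
    · simpa [BoundedFormula.realize_rel₁, BoundedFormula.realize_rel₂, Fin.snoc] using h₈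
    · simpa [BoundedFormula.realize_rel₁, Fin.snoc] using h₉

end Sentence

section LinearOrder

variable {M : Type} [LinearOrder M] {κ : Cardinal.{0}}

theorem mk_biUnion_Iic_le (hκ : ℵ₀ ≤ κ) (s : Set M) (h : ∀ x ∈ s, #(Iio x) ≤ κ) {μ : Cardinal}
    (hs : #s ≤ μ) (hμ : κ ≤ μ) : #(⋃ x ∈ s, Iic x : Set M) ≤ μ := by
  refine (mk_biUnion_le _ s).trans ?_
  refine (mul_le_mul' hs (ciSup_le' fun x => ?_)).trans
    (mul_eq_max (hκ.trans hμ) hκ |>.trans_le (max_le le_rfl hμ))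
  rw [← Iio_insert]
  exact mk_insert_le.trans (add_le_of_le hκ (h x x.2) (one_le_aleph0.trans hκ))

/-- A linear order all of whose proper initial segments have size at most `κ` has size at most
`κ⁺`. -/
theorem mk_le_succ_of_mk_Iio_le (hκ : ℵ₀ ≤ κ) (h : ∀ x : M, #(Iio x) ≤ κ) :
    #M ≤ Order.succ κ := by
  by_contra! hM
  obtain ⟨s, hs⟩ := le_mk_iff_exists_set.1 hM.le
  refine hM.not_ge ?_
  rw [← mk_univ]
  refine (mk_le_mk_of_subset fun x _ => ?_).trans
    (mk_biUnion_Iic_le hκ s (fun x _ => h x) hs.le (Order.le_succ κ))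
  by_contra! hx
  simp only [mem_iUnion, mem_Iic, not_exists, not_le] at hx
  exact ((Order.lt_succ κ).trans_eq hs.symm).not_ge
    ((mk_le_mk_of_subset fun y hy => hx y hy).trans (h x))

/-- A set of size greater than `κ` all of whose points have at most `κ` predecessors contains a
cofinal sequence of length `κ⁺`. -/
theorem exists_strictMono_cofinal (hκ : ℵ₀ ≤ κ) (P : Set M) (hP : κ < #P)
    (h : ∀ x ∈ P, #(Iio x) ≤ κ) :
    ∃ f : (Order.succ κ).ord.ToType → M, StrictMono f ∧ (∀ i, f i ∈ P) ∧ ∀ p ∈ P, ∃ i, p < f i := by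
  have key : ∀ s : Set M, s ⊆ P → #s ≤ κ → ∃ p ∈ P, ∀ x ∈ s, x < p := by
    intro s hsP hs
    by_contra! H
    refine hP.not_ge ((mk_le_mk_of_subset fun p hp => ?_).trans
      (mk_biUnion_Iic_le hκ s (fun x hx => h x (hsP hx)) hs le_rfl))
    obtain ⟨x, hx, hpx⟩ := H p hp
    exact mem_biUnion hx hpx
  have : Nonempty M := by
    obtain ⟨p⟩ := mk_ne_zero_iff.1 (pos_of_gt hP).ne'
    exact ⟨p⟩
  choose! b hbP hb using key
  let f : (Order.succ κ).ord.ToType → M :=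
    WellFoundedLT.fix fun i F => b {x | ∃ j, ∃ hj : j < i, F j hj = x}
  have hf : ∀ i, f i = b (f '' Iio i) := by
    intro i
    simp only [f]
    rw [WellFoundedLT.fix_eq]
    congr 1
    ext x
    simp
  have hcard : ∀ i, #(f '' Iio i) ≤ κ := fun i =>
    mk_image_le.trans (Order.lt_succ_iff.1 ((mk_Iio_lt i (by simp)).trans_eq (mk_ord_toType _)))
  have hfP : ∀ i, f i ∈ P := by
    intro i
    induction i using WellFoundedLT.induction with
    | ind i ih =>
      rw [hf]
      exact hbP _ (image_subset_iff.2 ih) (hcard i)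
  have hmono : StrictMono f := fun i j hij => by
    rw [hf j]
    exact hb _ (image_subset_iff.2 fun k _ => hfP k) (hcard j) _ (mem_image_of_mem f hij)
  refine ⟨f, hmono, hfP, fun p hp => ?_⟩
  by_contra! H
  have H' : ∀ i, f i < p := by
    intro i
    have : NoMaxOrder (Order.succ κ).ord.ToType := noMaxOrder (hκ.trans (Order.le_succ κ))
    obtain ⟨j, hj⟩ := exists_gt i
    exact (hmono hj).trans_le (H j)
  have := mk_le_of_injective (f := fun i => (⟨f i, H' i⟩ : Iio p))
    fun i j hij => hmono.injective (congrArg Subtype.val hij)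
  rw [mk_ord_toType] at this
  exact (Order.lt_succ κ).not_ge (this.trans (h p hp))

end LinearOrder

section TreeOfCode

variable {I B V : Type} {c : I → B → V}

/-- The nodes of the tree of restrictions of the branches coded by `c`. -/
def Node (c : I → B → V) : Type := {n : I × V // ∃ x, c n.1 x = n.2}

/-- The node at level `i` of the branch coded by `x`. -/
def node (c : I → B → V) (i : I) (x : B) : Node c := ⟨(i, c i x), x, rfl⟩

/-- The level of a node. -/
def Node.level (n : Node c) : I := n.1.1

theorem Node.eq_node (n : Node c) : ∃ x, n = node c n.level x := by
  obtain ⟨x, hx⟩ := n.2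
  exact ⟨x, Subtype.ext (Prod.ext rfl hx.symm)⟩

@[simp] theorem level_node (i : I) (x : B) : (node c i x).level = i := rfl

theorem node_eq_node_iff {i j : I} {x y : B} : node c i x = node c j y ↔ i = j ∧ c i x = c j y :=
  Subtype.ext_iff.trans Prod.ext_iff

variable [LinearOrder I]

/-- The tree order: `m ≤ n` if some branch passes through `m` and later `n`. -/
@[reducible]
def nodeOrder (hc : ∀ i j x y, i ≤ j → c j x = c j y → c i x = c i y) : PartialOrder (Node c) where
  le m n := m.level ≤ n.level ∧ ∃ x, m = node c m.level x ∧ n = node c n.level x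
  le_refl n := ⟨le_rfl, by simpa using n.eq_node⟩
  le_trans := by
    rintro l m n ⟨h₁, x, hl, hm⟩ ⟨h₂, y, hm', hn⟩
    refine ⟨h₁.trans h₂, y, ?_, hn⟩
    rw [hm, node_eq_node_iff] at hm'
    rw [hl]
    exact node_eq_node_iff.2 ⟨rfl, hc _ _ _ _ h₁ hm'.2⟩
  le_antisymm := by
    rintro m n ⟨h₁, x, hm, hn⟩ ⟨h₂, -⟩
    rw [hm, hn, le_antisymm h₁ h₂]

variable (hc : ∀ i j x y, i ≤ j → c j x = c j y → c i x = c i y)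

theorem node_le_node {i j : I} (h : i ≤ j) (x : B) :
    (nodeOrder hc).le (node c i x) (node c j x) := ⟨h, x, rfl, rfl⟩

theorem node_lt_node_iff {i j : I} {x : B} :
    (nodeOrder hc).lt (node c i x) (node c j x) ↔ i < j := by
  let := nodeOrder hc
  change node c i x < node c j x ↔ i < j
  constructor
  · intro h
    exact lt_of_le_of_ne h.le.1 fun e => h.ne (by rw [e])
  · intro h
    exact lt_of_le_of_ne (node_le_node hc h.le x) fun e => h.ne (node_eq_node_iff.1 e).1

/-- The predecessors of a node correspond to the smaller levels. -/
noncomputable def predIso (n : Node c) :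
    @predRel _ (nodeOrder hc) n ≃r ((· < ·) : Iio n.level → Iio n.level → Prop) :=
  letI := nodeOrder hc
  have hx := n.eq_node.choose_spec
  RelIso.symm
  { toFun := fun i => ⟨node c i n.eq_node.choose, by
      rw [mem_Iio]; conv_rhs => rw [hx]
      exact (node_lt_node_iff hc).2 i.2⟩
    invFun := fun m => ⟨m.1.level, by
      have h := m.2
      rw [mem_Iio] at h
      exact lt_of_le_of_ne h.le.1 fun e => h.ne (by
        obtain ⟨-, x, h₁, h₂⟩ := h.le
        exact h₁.trans ((congrArg (node c · x) e).trans h₂.symm))⟩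
    left_inv := fun i => rfl
    right_inv := fun m => by
      obtain ⟨hle, x, h₁, h₂⟩ := (show m.1 < n from m.2).le
      refine Subtype.ext ?_
      conv_rhs => rw [h₁]
      refine node_eq_node_iff.2 ⟨rfl, hc _ _ _ _ hle ?_⟩
      exact (node_eq_node_iff.1 (hx.symm.trans h₂)).2
    map_rel_iff' := fun {i j} => node_lt_node_iff hc }

variable [WellFoundedLT I]

/-- The tree of a coherent code. -/
noncomputable def tree : STree where
  carrier := Node c
  po := nodeOrder hc
  wo n := (predIso hc n).toRelEmbedding.isWellOrder

theorem ht_tree (n : Node c) : (tree hc).ht n = Ordinal.typein (α := I) (· < ·) n.level := by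
  rw [← Ordinal.type_Iio_lt]
  exact @Ordinal.type_eq _ _ _ _ ((tree hc).wo n) _ |>.2 ⟨predIso hc n⟩

theorem isKurepaTree_tree {β : Cardinal.{0}}
    (hI : Ordinal.type (α := I) (· < ·) = (Order.succ β).ord)
    (hB : Order.succ (Order.succ β) ≤ #B) (hV : #V ≤ β)
    (hsep : ∀ x y, x ≠ y → ∃ i, c i x ≠ c i y) : IsKurepaTree β (tree hc) := by
  have hBne : Nonempty B := mk_ne_zero_iff.1 (ne_of_gt ((Order.bot_lt_succ _).trans_le hB))
  refine ⟨fun t => ?_, fun α hα => ?_, ?_⟩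
  · exact (ht_tree hc t).trans_lt ((Ordinal.typein_lt_type _ _).trans_eq hI)
  · obtain ⟨i, rfl⟩ := Ordinal.typein_surj (α := I) (· < ·) (hI ▸ hα)
    refine ⟨⟨node c i hBne.some, ht_tree hc _⟩, ?_⟩
    refine (mk_le_of_injective (f := fun t => t.1.1.2) ?_).trans hV
    rintro ⟨s, hs⟩ ⟨t, ht⟩ hst
    have h : s.level = t.level := by
      have := (ht_tree hc s).symm.trans (Eq.trans hs (Eq.symm ht)) |>.trans (ht_tree hc t)
      exact Ordinal.typein_injective _ this
    exact Subtype.ext (Subtype.ext (Prod.ext h hst))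
  · refine hB.trans (mk_le_of_injective (f := fun x => ⟨range fun i => node c i x, ?_, ?_⟩) ?_)
    · rintro _ ⟨i, rfl⟩ _ ⟨j, rfl⟩ -
      exact (le_total i j).imp (node_le_node hc · x) (node_le_node hc · x)
    · intro α hα
      obtain ⟨i, rfl⟩ := Ordinal.typein_surj (α := I) (· < ·) (hI ▸ hα)
      exact ⟨_, ⟨i, rfl⟩, ht_tree hc _⟩
    · intro x y hxy
      by_contra hne
      obtain ⟨i, hi⟩ := hsep x y hne
      have h : range (fun i => node c i x) = range fun i => node c i y := congrArg Subtype.val hxy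
      obtain ⟨j, hj⟩ := h ▸ mem_range_self (f := fun i => node c i x) i
      obtain ⟨rfl, h⟩ := node_eq_node_iff.1 hj
      exact hi h.symm

end TreeOfCode

theorem IsModel.exists_isKurepaTree {M : Type} {r : M → M → Prop} {U P : Set M} {g c : M → M → M}
    (h : IsModel r U P g c) {β : Cardinal.{0}} (hβ : ℵ₀ ≤ β)
    (hM : #M = Order.succ (Order.succ β)) (hU : #U = β) : ∃ S, IsKurepaTree β S := by
  classical
  have : IsStrictTotalOrder M r :=
    { irrefl := h.irrefl
      trans := h.trans
      trichotomous := fun x y h₁ h₂ => by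
        have := h.trichotomous x y
        tauto }
  let := linearOrderOfSTO r
  have hPcard : β < #P := by
    by_contra! hP
    refine (Order.lt_succ (Order.succ β)).not_ge (hM ▸ mk_le_succ_of_mk_Iio_le hβ fun x => ?_)
    refine (mk_le_of_injective (f := fun y : Iio x => (⟨g x y, h.inj_mem x y y.2⟩ : P)) ?_).trans hP
    exact fun y z hyz => Subtype.ext (h.inj x y z y.2 z.2 (congrArg Subtype.val hyz))
  have hPini : ∀ x ∈ P, #(Iio x) ≤ β := by
    intro x hx
    refine (mk_le_of_injective
      (f := fun y : Iio x => (⟨g x y, h.inj_mem_small x y hx y.2⟩ : U)) ?_).trans hU.le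
    exact fun y z hyz => Subtype.ext (h.inj x y z y.2 z.2 (congrArg Subtype.val hyz))
  obtain ⟨f, hf, hfP, hcof⟩ := exists_strictMono_cofinal hβ P hPcard hPini
  have hc : ∀ i j x y, i ≤ j → (⟨c (f j) x, h.code_mem _ x (hfP j)⟩ : U) =
      ⟨c (f j) y, h.code_mem _ y (hfP j)⟩ → (⟨c (f i) x, h.code_mem _ x (hfP i)⟩ : U) =
      ⟨c (f i) y, h.code_mem _ y (hfP i)⟩ := by
    intro i j x y hij hxy
    rcases hij.eq_or_lt with rfl | hij
    · exact hxy
    · exact Subtype.ext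
        (h.coherent _ _ x y (hfP i) (hfP j) (hf hij) (congrArg Subtype.val hxy))
  refine ⟨tree (c := fun i x => (⟨c (f i) x, h.code_mem _ x (hfP i)⟩ : U)) hc,
    isKurepaTree_tree hc (Ordinal.type_toType _) hM.ge hU.le fun x y hxy => ?_⟩
  obtain ⟨p, hp, hpxy⟩ := h.separates x y hxy
  obtain ⟨i, hi⟩ := hcof p hp
  exact ⟨i, fun e => hpxy (h.coherent _ _ x y hp (hfP i) hi (congrArg Subtype.val e))⟩

section CodeOfTree

theorem ht_lt_ht (S : STree) {s t : S.carrier} (h : s < t) : S.ht s < S.ht t := by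
  have := S.wo s
  have := S.wo t
  refine Ordinal.type_lt_iff.2 ⟨⟨⟨⟨fun a => ⟨a.1, lt_trans a.2 h⟩, fun a b hab =>
    Subtype.ext (congrArg (fun x : Iio t => x.1) hab)⟩, Iff.rfl⟩, ⟨s, h⟩, fun b => ?_⟩⟩
  exact ⟨fun ⟨a, ha⟩ => ha ▸ a.2, fun hb => ⟨⟨b.1, hb⟩, rfl⟩⟩

theorem eq_of_le_of_ht_eq (S : STree) {s t u : S.carrier} (hs : s ≤ u) (ht : t ≤ u)
    (h : S.ht s = S.ht t) : s = t := by
  rcases hs.eq_or_lt with rfl | hs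
  · exact ((ht.eq_or_lt).resolve_right fun h' => (ht_lt_ht S h').ne' h).symm
  rcases ht.eq_or_lt with rfl | ht
  · exact absurd h (ht_lt_ht S hs).ne
  have := S.wo u
  rcases trichotomous_of (predRel u) ⟨s, hs⟩ ⟨t, ht⟩ with h' | h' | h'
  · exact absurd h (ht_lt_ht S h').ne
  · exact congrArg Subtype.val h'
  · exact absurd h (ht_lt_ht S h').ne'

theorem exists_code {β : Cardinal.{0}} {S : STree} (hS : IsKurepaTree β S) {M : Type}
    (hM : #M = Order.succ (Order.succ β)) {U : Set M} (hU : #U = β) :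
    ∃ c : Ordinal.{0} → M → M, (∀ i < (Order.succ β).ord, ∀ x, c i x ∈ U) ∧
      (∀ i j x y, i ≤ j → j < (Order.succ β).ord → c j x = c j y → c i x = c i y) ∧
      ∀ x y, x ≠ y → ∃ i < (Order.succ β).ord, c i x ≠ c i y := by
  obtain ⟨hht, hlev, hbr⟩ := hS
  rw [← hM] at hbr
  obtain ⟨b⟩ := hbr
  have hnode : ∀ x, ∀ i < (Order.succ β).ord, ∃ t ∈ (b x).1, t ∈ S.Level i := fun x => (b x).2.2
  have hne : Nonempty S.carrier :=
    have h0 : (0 : Ordinal) < (Order.succ β).ord := by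
      rw [lt_ord]; simp
    ⟨(hlev 0 h0).1.some⟩
  choose! n hnb hnl using hnode
  have hemb : ∀ i < (Order.succ β).ord, ∃ e : S.carrier → M,
      (∀ t ∈ S.Level i, e t ∈ U) ∧ InjOn e (S.Level i) := by
    intro i hi
    obtain ⟨e⟩ := (hlev i hi).2.trans hU.ge
    classical
    have : Nonempty M := ⟨e ⟨_, (hlev i hi).1.some_mem⟩⟩
    refine ⟨fun t => if h : t ∈ S.Level i then e ⟨t, h⟩ else Classical.arbitrary M,
      fun t ht => by simp [ht], fun s hs t ht hst => ?_⟩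
    simp only [hs, ht, dif_pos] at hst
    exact congrArg Subtype.val (e.injective (Subtype.ext hst))
  have : Nonempty M := mk_ne_zero_iff.1 (hM ▸ (Order.bot_lt_succ _).ne')
  choose! e heU he using hemb
  have hnle : ∀ x i j, i ≤ j → j < (Order.succ β).ord → n x i ≤ n x j := by
    intro x i j hij hj
    have hi := hij.trans_lt hj
    refine ((b x).2.1.total (hnb x i hi) (hnb x j hj)).elim id fun h => ?_
    rcases h.eq_or_lt with h | h
    · exact h.ge
    · have := ht_lt_ht S h
      rw [show S.ht _ = _ from hnl x i hi, show S.ht _ = _ from hnl x j hj] at this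
      exact absurd hij this.not_ge
  refine ⟨fun i x => e i (n x i), fun i hi x => heU i hi _ (hnl x i hi), ?_, ?_⟩
  · intro i j x y hij hj hxy
    have h := he j hj (hnl x j hj) (hnl y j hj) hxy
    have hi := hij.trans_lt hj
    have := eq_of_le_of_ht_eq S (hnle x i j hij hj) (h ▸ hnle y i j hij hj)
      (Eq.trans (hnl x i hi) (Eq.symm (hnl y i hi)))
    simp only [this]
  · intro x y hxy
    by_contra! H
    refine hxy (b.injective (Subtype.ext ?_))
    have hmem : ∀ x, (b x).1 = {t | n x (S.ht t) = t} := by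
      intro x
      ext t
      have hl := hnl x _ (hht t)
      have hb := hnb x _ (hht t)
      constructor
      · intro ht
        rcases (b x).2.1.total hb ht with h | h
        · exact eq_of_le_of_ht_eq S h le_rfl hl
        · exact (eq_of_le_of_ht_eq S h le_rfl (Eq.symm hl)).symm
      · intro ht
        rw [← show n x (S.ht t) = t from ht]
        exact hb
    rw [hmem, hmem]
    ext t
    have := he _ (hht t) (hnl x _ (hht t)) (hnl y _ (hht t)) (H _ (hht t))
    simp only [mem_ofPred_eq, this]

end CodeOfTree

theorem exists_isModel {β : Cardinal.{0}} {S : STree} (hS : IsKurepaTree β S) :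
    ∃ (M : Type) (r : M → M → Prop) (U P : Set M) (g c : M → M → M), IsModel r U P g c ∧
      #M = Order.succ (Order.succ β) ∧ #U = β := by
  let M := (Order.succ (Order.succ β)).ord.ToType
  have hM : #M = Order.succ (Order.succ β) := mk_ord_toType _
  let ty : M → Ordinal := Ordinal.typein (· < ·)
  have hseg : ∀ κ < Order.succ (Order.succ β), #{x : M | ty x < κ.ord} = κ := by
    intro κ hκ
    obtain ⟨x, hx⟩ := Ordinal.typein_surj (α := M) (· < ·) (o := κ.ord)
      (by rw [Ordinal.type_toType]; exact ord_lt_ord.2 hκ)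
    have : {x : M | ty x < κ.ord} = Iio x := by
      ext y
      simp [ty, ← hx]
    rw [this, ← card_ord κ, ← hx, ← Ordinal.type_Iio_lt, Ordinal.card_type]
  let U : Set M := {x | ty x < β.ord}
  let P : Set M := {x | ty x < (Order.succ β).ord}
  have hU : #U = β := hseg β ((Order.lt_succ _).trans (Order.lt_succ _))
  have hP : #P = Order.succ β := hseg _ (Order.lt_succ _)
  have hUP : U ⊆ P := fun x hx =>
    (show ty x < β.ord from hx).trans (ord_lt_ord.2 (Order.lt_succ β))
  have hM' : Nonempty M := mk_ne_zero_iff.1 (hM ▸ (Order.bot_lt_succ _).ne')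
  have hinj : ∀ (x : M) (V : Set M), #(Iio x) ≤ #V →
      ∃ g : M → M, InjOn g (Iio x) ∧ ∀ y < x, g y ∈ V := by
    rintro x V ⟨e⟩
    classical
    refine ⟨fun y => if h : y < x then e ⟨y, h⟩ else Classical.arbitrary M,
      fun y hy z hz hyz => ?_, fun y hy => by simp [hy]⟩
    rw [mem_Iio] at hy hz
    simp only [hy, hz, dif_pos] at hyz
    exact congrArg Subtype.val (e.injective (Subtype.ext hyz))
  have hinj' : ∀ x : M, ∃ g : M → M, InjOn g (Iio x) ∧ (∀ y < x, g y ∈ P) ∧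
      (x ∈ P → ∀ y < x, g y ∈ U) := by
    intro x
    by_cases hx : x ∈ P
    · have hcard : #(Iio x) ≤ #U := by
        rw [hU, ← Order.lt_succ_iff, ← Ordinal.card_type (· < ·), Ordinal.type_Iio_lt]
        exact lt_ord.1 hx
      obtain ⟨g, hg, hgU⟩ := hinj x U hcard
      exact ⟨g, hg, fun y hy => hUP (hgU y hy), fun _ => hgU⟩
    · obtain ⟨g, hg, hgP⟩ := hinj x P
        (by
          rw [hP, ← Order.lt_succ_iff]
          exact (mk_Iio_lt x (by rw [hM]; exact (Ordinal.type_toType _).symm)).trans_eq hM)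
      exact ⟨g, hg, hgP, fun h => absurd h hx⟩
  choose g hg hgP hgU using hinj'
  obtain ⟨c, hcU, hc, hsep⟩ := exists_code hS hM hU
  refine ⟨M, (· < ·), U, P, g, fun p x => c (ty p) x, ?_, hM, hU⟩
  exact
    { irrefl := lt_irrefl
      trans := fun _ _ _ => lt_trans
      trichotomous := fun x y => by rw [or_assoc]; exact lt_trichotomy x y
      inj := fun x y z hy hz h => hg x hy hz h
      inj_mem := hgP
      inj_mem_small := fun x y hx => hgU x hx y
      code_mem := fun p x hp => hcU _ hp x
      coherent := fun p q x y _ hq hpq =>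
        hc _ _ x y ((Ordinal.typein_lt_typein (· < ·)).2 hpq).le hq
      separates := fun x y hxy => by
        obtain ⟨i, hi, h⟩ := hsep x y hxy
        obtain ⟨p, rfl⟩ := Ordinal.typein_surj (α := M) (· < ·) (o := i) (by
          rw [Ordinal.type_toType]
          exact hi.trans (ord_lt_ord.2 (Order.lt_succ _)))
        exact ⟨p, hi, h⟩ }

end KurepaCode

/-- Vaught: there is a sentence `φ_KH` of a countable language with a
distinguished unary predicate `U` such that for every infinite cardinal `β`, `φ_KH` has
a `(β⁺⁺, β)`-model — a structure of cardinality `β⁺⁺` with `|U| = β` encoding a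
`β⁺`-Kurepa tree together with `β⁺⁺` of its cofinal branches — if and only if there
exists a `β⁺`-Kurepa tree. -/
theorem stmt17 :
    ∃ (L : FirstOrder.Language.{0,0}) (U : L.Relations 1) (φ : L.Sentence),
      L.card ≤ ℵ₀ ∧
      ∀ β : Cardinal.{0}, ℵ₀ ≤ β →
        (HasModelPair L U {φ} (Order.succ (Order.succ β)) β ↔
          ∃ S : STree, IsKurepaTree β S) := by
  refine ⟨KurepaCode.language, KurepaCode.small, KurepaCode.sentence,
    KurepaCode.card_language_le, fun β hβ => ⟨?_, ?_⟩⟩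
  · rintro ⟨M, i, hφ, hM, hU⟩
    rw [Language.Theory.model_singleton_iff, KurepaCode.realize_sentence] at hφ
    exact hφ.exists_isKurepaTree hβ hM hU
  · rintro ⟨S, hS⟩
    obtain ⟨M, r, U, P, g, c, h, hM, hU⟩ := KurepaCode.exists_isModel hS
    let i : KurepaCode.language.Structure M :=
      { funMap := fun f v => match f with
          | .inj => g (v 0) (v 1)
          | .code => c (v 0) (v 1)
        RelMap := fun R v => match R with
          | .small => v 0 ∈ U
          | .levels => v 0 ∈ P
          | .lt => r (v 0) (v 1) }
    refine ⟨M, i, ?_, hM, hU⟩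
    rw [Language.Theory.model_singleton_iff, KurepaCode.realize_sentence]
    exact h
end
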